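/- Let (U_i, 𝔅_i), i = 1,…,N, be measurable spaces whose σ-algebras contain all singletons, and let A, B : U = U_1 × ⋯ × U_N → ℝ be measurable functions such that A and B are integrable with respect to every product μ_1 × ⋯ × μ_N of probability measures μ_i on U_i and B is strictly of constant sign on U. If the test function C(u) = A(u)/B(u) is bounded below on U and attains its global minimum at a point u⁻ = (u_1⁻,…,u_N⁻) ∈ U, then the minimum of the linear-fractional integral functional I over all families (μ_1,…,μ_N) of probability measures exists and is attained at the family of degenerate (Dirac) measures (δ_{u_1⁻},…,δ_{u_N⁻}); moreover min over all families of I(μ_1,…,μ_N) = min over families of Dirac measures of I = I(δ_{u_1⁻},…,δ_{u_N⁻}) = min_{u ∈ U} A(u)/B(u) = A(u⁻)/B(u⁻). -/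

import Mathlib

open MeasureTheory

theorem pi_dirac_eq_dirac {ι : Type*} [Fintype ι] {X : ι → Type*}
    [∀ i, MeasurableSpace (X i)] (x : ∀ i, X i) :
    Measure.pi (fun i => Measure.dirac (x i)) = Measure.dirac x := by
  classical
  refine Measure.pi_eq fun s hs => ?_
  rw [Measure.dirac_apply' _ (MeasurableSet.univ_pi hs)]
  simp [Measure.dirac_apply' _ (hs _), Set.indicator_apply, Finset.prod_ite_zero]

theorem le_integral_div_integral_of_pos {Ω : Type*} [MeasurableSpace Ω] {P : Measure Ω}
    [IsProbabilityMeasure P] {f g : Ω → ℝ} {c : ℝ} (hf : Integrable f P) (hg : Integrable g P)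
    (hpos : ∀ ω, 0 < g ω) (hc : ∀ ω, c ≤ f ω / g ω) :
    c ≤ (∫ ω, f ω ∂P) / ∫ ω, g ω ∂P := by
  have hint : 0 < ∫ ω, g ω ∂P := by
    rw [integral_pos_iff_support_of_nonneg (fun ω => (hpos ω).le) hg]
    have hsupp : Function.support g = Set.univ :=
      Set.eq_univ_of_forall fun ω => (hpos ω).ne'
    simp [hsupp]
  rw [le_div_iff₀ hint, ← integral_const_mul]
  exact integral_mono (hg.const_mul c) hf fun ω => (le_div_iff₀ (hpos ω)).1 (hc ω)

theorem le_integral_div_integral {Ω : Type*} [MeasurableSpace Ω] {P : Measure Ω}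
    [IsProbabilityMeasure P] {f g : Ω → ℝ} {c : ℝ} (hf : Integrable f P) (hg : Integrable g P)
    (hsign : (∀ ω, 0 < g ω) ∨ ∀ ω, g ω < 0) (hc : ∀ ω, c ≤ f ω / g ω) :
    c ≤ (∫ ω, f ω ∂P) / ∫ ω, g ω ∂P := by
  rcases hsign with hpos | hneg
  · exact le_integral_div_integral_of_pos hf hg hpos hc
  · have h := le_integral_div_integral_of_pos (c := c) hf.neg hg.neg
      (fun ω => neg_pos.2 (hneg ω)) (fun ω => by simpa [neg_div_neg_eq] using hc ω)
    simpa [integral_neg, neg_div_neg_eq] using h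

/-- If the test function `C = A/B` attains its global minimum at `u⁻ ∈ U`, then the minimum
of the linear-fractional integral functional over all families of probability measures exists
and is attained at the family of Dirac measures concentrated at `u⁻`, with common value
`A(u⁻)/B(u⁻) = min_U C`. -/
theorem stmt_6 {N : ℕ} {U : Fin N → Type*} [∀ i, MeasurableSpace (U i)]
    [∀ i, MeasurableSingletonClass (U i)]
    (A B : ((i : Fin N) → U i) → ℝ)
    (hAm : Measurable A) (hBm : Measurable B)
    (hA : ∀ μ : ∀ i, Measure (U i), (∀ i, IsProbabilityMeasure (μ i)) →
      Integrable A (Measure.pi μ))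
    (hB : ∀ μ : ∀ i, Measure (U i), (∀ i, IsProbabilityMeasure (μ i)) →
      Integrable B (Measure.pi μ))
    (hBsign : (∀ u, 0 < B u) ∨ (∀ u, B u < 0))
    (uminus : (i : Fin N) → U i)
    (hmin : ∀ u, A uminus / B uminus ≤ A u / B u) :
    IsLeast {r : ℝ | ∃ μ : ∀ i, Measure (U i), (∀ i, IsProbabilityMeasure (μ i)) ∧
        r = (∫ u, A u ∂Measure.pi μ) / (∫ u, B u ∂Measure.pi μ)}
      (A uminus / B uminus) ∧
    IsLeast {r : ℝ | ∃ w : (i : Fin N) → U i,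
        r = (∫ v, A v ∂Measure.pi fun i => Measure.dirac (w i)) /
          (∫ v, B v ∂Measure.pi fun i => Measure.dirac (w i))}
      (A uminus / B uminus) ∧
    (∫ v, A v ∂Measure.pi fun i => Measure.dirac (uminus i)) /
      (∫ v, B v ∂Measure.pi fun i => Measure.dirac (uminus i)) = A uminus / B uminus := by
  have hdirac (w : (i : Fin N) → U i) :
      (∫ v, A v ∂Measure.pi fun i => Measure.dirac (w i)) /
        (∫ v, B v ∂Measure.pi fun i => Measure.dirac (w i)) = A w / B w := by
    rw [pi_dirac_eq_dirac, integral_dirac' _ _ hAm.stronglyMeasurable,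
      integral_dirac' _ _ hBm.stronglyMeasurable]
  refine ⟨⟨⟨fun i => Measure.dirac (uminus i), fun i => inferInstance, (hdirac uminus).symm⟩, ?_⟩,
    ⟨⟨uminus, (hdirac uminus).symm⟩, ?_⟩, hdirac uminus⟩
  · rintro r ⟨μ, hμ, rfl⟩
    exact le_integral_div_integral (hA μ hμ) (hB μ hμ) hBsign hmin
  · rintro r ⟨w, rfl⟩
    rw [hdirac w]
    exact hmin w
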